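/- Let q be a real number with q > 0 and q ≠ 1, let h be an integer with h ≥ 1, and let n be a natural number with n ≥ 1. Then Σ_{l=0}^{n} binom(n,l) · (-1)^l · G_{l+1}^{(h)}(q)/(l+1) = (1+q) + q^{h+1} · G_{n+1}^{(h)}(q^{-1})/(n+1). -/

import Mathlib

/-- The q-analogue of a real number `x`: `[x]_q = (1 - q^x)/(1 - q)`,
where `q^x` is a real power of the positive base `q`. -/
noncomputable def qnum (q x : ℝ) : ℝ := (1 - q ^ x) / (1 - q)

/-- The (h,q)-Genocchi polynomial `G_m^{(h)}(x|q)`: `G_0^{(h)}(x|q) = 0` and for `m ≥ 1`,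
`G_m^{(h)}(x|q) = m (1+q)/(1-q)^{m-1} ∑_{k=0}^{m-1} C(m-1,k) (-1)^k q^{kx}/(1+q^{h+k})`,
with real powers of the positive base `q`. -/
noncomputable def hqGenocchi (h : ℤ) (q : ℝ) (m : ℕ) (x : ℝ) : ℝ :=
  if m = 0 then 0
  else (m : ℝ) * (1 + q) / (1 - q) ^ (m - 1) *
    ∑ k ∈ Finset.range m, ((m - 1).choose k : ℝ) * (-1 : ℝ) ^ k *
      q ^ ((k : ℝ) * x) / (1 + q ^ ((h : ℝ) + (k : ℝ)))

open Polynomial in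
theorem aux_pow (P : ℝ[X]) (r s : ℝ) (n : ℕ) :
    (C r * P + C s) ^ n =
      ∑ k ∈ Finset.range (n + 1), ((n.choose k : ℝ) * r ^ k * s ^ (n - k)) • P ^ k := by
  rw [add_pow]
  refine Finset.sum_congr rfl fun k _ => ?_
  rw [Polynomial.smul_eq_C_mul]
  simp only [map_mul, map_pow, map_natCast, mul_pow]
  ring

open Polynomial in
theorem aux_sum (a : ℕ → ℝ) (q c : ℝ) (hc : c * (1 - q) = 1) (n : ℕ) :
    ∑ l ∈ Finset.range (n + 1), ((n.choose l : ℝ) * (-c) ^ l) *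
      ∑ k ∈ Finset.range (l + 1), ((l.choose k : ℝ) * (-1) ^ k) * a k =
    c ^ n * ∑ k ∈ Finset.range (n + 1), ((n.choose k : ℝ) * (-q) ^ (n - k)) * a k := by
  let L : ℝ[X] →ₗ[ℝ] ℝ := Polynomial.lsum (fun k => (a k) • LinearMap.id)
  have hL : ∀ k, L (X ^ k) = a k := by
    intro k
    simp [L, Polynomial.lsum_apply, ← Polynomial.monomial_one_right_eq_X_pow,
      Polynomial.sum_monomial_index]
  have h1 := aux_pow (C (-1) * X + C 1) (-c) 1 n
  have h2 := aux_pow X 1 (-q) n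
  have h3 : (C (-c) * (C (-1) * X + C 1) + C 1 : ℝ[X]) = C c * (C 1 * X + C (-q)) := by
    have : (1 : ℝ) - c = -(q * c) := by linarith
    have h4 : (1 : ℝ[X]) - C c = -(C q * C c) := by
      rw [← C_mul, ← C_neg, ← this]; simp
    simp only [map_neg, map_one]
    linear_combination h4
  rw [h3, mul_pow, h2, ← C_pow, ← smul_eq_C_mul] at h1
  have h5 := congrArg L h1
  simp only [aux_pow X (-1) 1] at h5
  simp only [map_smul, map_sum, hL, smul_eq_mul, one_pow, mul_one] at h5
  exact h5.symm

theorem aux_gen (h : ℤ) (q : ℝ) (l : ℕ) : hqGenocchi h q (l + 1) 0 / ((l : ℝ) + 1) =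
    (1 + q) * ((1 - q)⁻¹ ^ l * ∑ k ∈ Finset.range (l + 1),
      ((l.choose k : ℝ) * (-1) ^ k) * (1 + q ^ (h + (k : ℤ)))⁻¹) := by
  have hl : (l : ℝ) + 1 ≠ 0 := by positivity
  have e : ∀ k : ℕ, q ^ ((h : ℝ) + (k : ℝ)) = q ^ (h + (k : ℤ)) := fun k => by
    rw [← Real.rpow_intCast]; push_cast; rfl
  simp only [hqGenocchi, e, div_eq_mul_inv]
  simp
  field_simp

theorem statement7 (q : ℝ) (hq0 : 0 < q) (hq1 : q ≠ 1) (h : ℤ) (hh : 1 ≤ h)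
    (n : ℕ) (hn : 1 ≤ n) :
    ∑ l ∈ Finset.range (n + 1), (n.choose l : ℝ) * (-1 : ℝ) ^ l *
        hqGenocchi h q (l + 1) 0 / ((l : ℝ) + 1) =
      (1 + q) + q ^ ((h : ℝ) + 1) * hqGenocchi h q⁻¹ (n + 1) 0 / ((n : ℝ) + 1) := by
  simp only [mul_div_assoc, aux_gen]
  have e : q ^ ((h : ℝ) + 1) = q ^ h * q := by
    rw [← zpow_add_one₀ hq0.ne', ← Real.rpow_intCast]; push_cast; rfl
  rw [e]
  have hq : 1 - q ≠ 0 := sub_ne_zero.2 hq1.symm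
  have hq' : q - 1 ≠ 0 := sub_ne_zero.2 hq1
  set a : ℕ → ℝ := fun k => (1 + q ^ (h + (k : ℤ)))⁻¹ with ha
  have hpos : ∀ k : ℕ, 0 < 1 + q ^ (h + (k : ℤ)) := fun k => by positivity
  have hinv : ∀ k : ℕ, (1 + q⁻¹ ^ (h + (k : ℤ)))⁻¹ = 1 - a k := fun k => by
    have h1 := (hpos k).ne'
    have h2 : 0 < q ^ (h + (k : ℤ)) := by positivity
    simp only [ha, inv_zpow]
    generalize q ^ (h + (k : ℤ)) = y at *
    have : 0 < y + 1 := by linarith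
    field_simp
    ring
  have hS := aux_sum a q (1 - q)⁻¹ (inv_mul_cancel₀ hq) n
  have hL : ∑ l ∈ Finset.range (n + 1), (n.choose l : ℝ) * (-1 : ℝ) ^ l * ((1 + q) *
      ((1 - q)⁻¹ ^ l * ∑ k ∈ Finset.range (l + 1), ((l.choose k : ℝ) * (-1) ^ k) * a k)) =
      (1 + q) * ((1 - q)⁻¹ ^ n *
        ∑ k ∈ Finset.range (n + 1), ((n.choose k : ℝ) * (-q) ^ (n - k)) * a k) := by
    rw [← hS, Finset.mul_sum]
    refine Finset.sum_congr rfl fun l _ => ?_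
    rw [neg_pow (1 - q)⁻¹]; ring
  have h0 : ∑ k ∈ Finset.range (n + 1), ((n.choose k : ℝ) * (-1) ^ k) = 0 := by
    have := add_pow (-1 : ℝ) 1 n
    rw [neg_add_cancel, zero_pow (by omega)] at this
    rw [this]
    refine Finset.sum_congr rfl fun l _ => ?_
    simp [mul_comm]
  have hsub : ∑ k ∈ Finset.range (n + 1), ((n.choose k : ℝ) * (-1) ^ k) *
      (1 + q⁻¹ ^ (h + (k : ℤ)))⁻¹ =
      - ∑ k ∈ Finset.range (n + 1), ((n.choose k : ℝ) * (-1) ^ k) * a k := by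
    simp only [hinv, mul_sub, mul_one, Finset.sum_sub_distrib, h0, zero_sub]
  have key : ∑ k ∈ Finset.range (n + 1), ((n.choose k : ℝ) * (-q) ^ (n - k)) * a k +
      q ^ h * (-q) ^ n * ∑ k ∈ Finset.range (n + 1), ((n.choose k : ℝ) * (-1) ^ k) * a k
      = (1 - q) ^ n := by
    rw [sub_eq_add_neg, add_pow, Finset.mul_sum, ← Finset.sum_add_distrib]
    refine Finset.sum_congr rfl fun k hk => ?_
    have hk' : k ≤ n := by simpa [Nat.lt_succ_iff] using hk
    have hs : (-q) ^ n = (-q) ^ (n - k) * (-q) ^ k := by rw [← pow_add, Nat.sub_add_cancel hk']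
    have hm : (-q) ^ k * (-1) ^ k = q ^ k := by rw [← mul_pow]; simp
    have hz : a k * (1 + q ^ h * q ^ k) = 1 := by
      rw [← zpow_natCast q k, ← zpow_add₀ hq0.ne']
      exact inv_mul_cancel₀ (hpos k).ne'
    rw [hs, one_pow]
    linear_combination (n.choose k : ℝ) * (-q) ^ (n - k) * hz +
      q ^ h * (-q) ^ (n - k) * n.choose k * a k * hm
  have hi : (1 - q⁻¹)⁻¹ = (-q) * (1 - q)⁻¹ := by
    have : 1 - q⁻¹ = (1 - q) * (-q)⁻¹ := by field_simp; ring
    rw [this, mul_inv, inv_inv, mul_comm]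
  have hc : (1 - q)⁻¹ ^ n * (1 - q) ^ n = 1 := by rw [← mul_pow, inv_mul_cancel₀ hq, one_pow]
  have hqq : q * (1 + q⁻¹) = 1 + q := by field_simp; ring
  refine hL.trans ?_
  rw [hsub, hi, mul_pow]
  generalize ∑ k ∈ Finset.range (n + 1), ((n.choose k : ℝ) * (-1) ^ k) * a k = S at *
  generalize ∑ k ∈ Finset.range (n + 1), ((n.choose k : ℝ) * (-q) ^ (n - k)) * a k = T at *
  linear_combination (1 + q) * (1 - q)⁻¹ ^ n * key + (1 + q) * hc +
    q ^ h * (-q) ^ n * (1 - q)⁻¹ ^ n * S * hqq
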